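/- Let u ∈ (1/2,1) and let m̃ = m̃(u) ∈ (1,2) be the unique solution in (1,2) of the equation dc²(K(1 − 1/m)u | 1 − 1/m) − dc²(K(1/m)u | 1/m) = 1. Then for all m ∈ (1, m̃) one has |sn(K(m)u | m)| > 1, while for all m ∈ (m̃, 2) one has |sn(K(m)u | m)| < 1; here |sn(K(m)u | m)| denotes the continuous extension of the modulus to the cut (1,∞), given by |sn(K(m)u|m)|² = μ·(s²d₁² + c²d²s₁²c₁²)/(1 − d²s₁²)² with μ = 1/m, μ₁ = 1 − μ, s = sn(K(μ)u|μ), etc. -/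

import Mathlib

noncomputable section

open Complex Filter Set Asymptotics

/-- Complete elliptic integral of the first kind with complex parameter `m`,
using the principal branch of the square root. -/
def ellK (m : ℂ) : ℂ :=
  ∫ t in (0:ℝ)..1, 1 / ((1 - (t : ℂ) ^ 2) * (1 - m * (t : ℂ) ^ 2)) ^ ((1 : ℂ) / 2)

/-- The nome `q = exp (-π K(1-m)/K(m))`. -/
def nome (m : ℂ) : ℂ := Complex.exp (-(Real.pi : ℂ) * ellK (1 - m) / ellK m)

/-- Jacobi theta function θ₁(z, q). -/
def theta1 (z q : ℂ) : ℂ :=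
  2 * ∑' n : ℕ, (-1 : ℂ) ^ n * q ^ (((n : ℂ) + 1 / 2) ^ 2) *
    Complex.sin ((2 * (n : ℂ) + 1) * z)

/-- Jacobi theta function θ₂(z, q). -/
def theta2 (z q : ℂ) : ℂ :=
  2 * ∑' n : ℕ, q ^ (((n : ℂ) + 1 / 2) ^ 2) * Complex.cos ((2 * (n : ℂ) + 1) * z)

/-- Jacobi theta function θ₃(z, q). -/
def theta3 (z q : ℂ) : ℂ :=
  1 + 2 * ∑' n : ℕ, q ^ ((n + 1) ^ 2) * Complex.cos (2 * ((n : ℂ) + 1) * z)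

/-- Jacobi theta function θ₄(z, q). -/
def theta4 (z q : ℂ) : ℂ :=
  1 + 2 * ∑' n : ℕ, (-1 : ℂ) ^ (n + 1) * q ^ ((n + 1) ^ 2) *
    Complex.cos (2 * ((n : ℂ) + 1) * z)

/-- Jacobian elliptic function sn(z | m) with complex argument and parameter,
defined through quotients of Jacobi theta functions with nome
`q = exp (-π K(1-m)/K(m))` (so that `sn (K m * u) m` corresponds to the
theta quotient at `π u / 2`). -/
def sn (z m : ℂ) : ℂ :=
  (theta3 0 (nome m) / theta2 0 (nome m)) *
    (theta1 ((Real.pi : ℂ) * z / (2 * ellK m)) (nome m) /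
      theta4 ((Real.pi : ℂ) * z / (2 * ellK m)) (nome m))

/-- Jacobian elliptic function cn(z | m). -/
def cn (z m : ℂ) : ℂ :=
  (theta4 0 (nome m) / theta2 0 (nome m)) *
    (theta2 ((Real.pi : ℂ) * z / (2 * ellK m)) (nome m) /
      theta4 ((Real.pi : ℂ) * z / (2 * ellK m)) (nome m))

/-- Jacobian elliptic function dn(z | m). -/
def dn (z m : ℂ) : ℂ :=
  (theta4 0 (nome m) / theta3 0 (nome m)) *
    (theta3 ((Real.pi : ℂ) * z / (2 * ellK m)) (nome m) /
      theta4 ((Real.pi : ℂ) * z / (2 * ellK m)) (nome m))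

/-- The lattice ratio τ = i K(1-m)/K(m). -/
def tauC (m : ℂ) : ℂ := Complex.I * ellK (1 - m) / ellK m

/-- Subsidiary Jacobian elliptic function sc = sn/cn. -/
def sc (z m : ℂ) : ℂ := sn z m / cn z m

/-- Subsidiary Jacobian elliptic function nc = 1/cn. -/
def nc (z m : ℂ) : ℂ := 1 / cn z m

/-- Subsidiary Jacobian elliptic function dc = dn/cn. -/
def dcC (z m : ℂ) : ℂ := dn z m / cn z m

/-- The branch cut [1, ∞) on the real axis. -/
def cut : Set ℂ := {z : ℂ | z.im = 0 ∧ 1 ≤ z.re}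

/-- Real complete elliptic integral of the first kind (for real parameter `m < 1`
the complex integral is real-valued). -/
def KR (m : ℝ) : ℝ := (ellK (m : ℂ)).re

/-- Classical real Jacobian elliptic function sn(x | m). -/
def snR (x m : ℝ) : ℝ := (sn (x : ℂ) (m : ℂ)).re

/-- Classical real Jacobian elliptic function cn(x | m). -/
def cnR (x m : ℝ) : ℝ := (cn (x : ℂ) (m : ℂ)).re

/-- Classical real Jacobian elliptic function dn(x | m). -/
def dnR (x m : ℝ) : ℝ := (dn (x : ℂ) (m : ℂ)).re

/-- φ(u, μ) = dc²(K(1-μ)u | 1-μ) − dc²(K(μ)u | μ) with real dc = dn/cn. -/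
def phi (u μ : ℝ) : ℝ :=
  (dnR (KR (1 - μ) * u) (1 - μ) / cnR (KR (1 - μ) * u) (1 - μ)) ^ 2 -
    (dnR (KR μ * u) μ / cnR (KR μ * u) μ) ^ 2

/-- The square of the continuously extended modulus |sn(K(m)u | m)|² for `m > 1`,
given by μ(s²d₁² + c²d²s₁²c₁²)/(1 − d²s₁²)² with μ = 1/m, μ₁ = 1 − μ. -/
def snAbsSq (u m : ℝ) : ℝ :=
  let μ := 1 / m
  let μ₁ := 1 - μ
  let s := snR (KR μ * u) μ
  let c := cnR (KR μ * u) μ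
  let d := dnR (KR μ * u) μ
  let s₁ := snR (KR μ₁ * u) μ₁
  let c₁ := cnR (KR μ₁ * u) μ₁
  let d₁ := dnR (KR μ₁ * u) μ₁
  μ * (s ^ 2 * d₁ ^ 2 + c ^ 2 * d ^ 2 * s₁ ^ 2 * c₁ ^ 2) / (1 - d ^ 2 * s₁ ^ 2) ^ 2


noncomputable def thB (z τ : ℂ) : ℂ :=
  cexp (Real.pi * I * z + Real.pi * I * τ / 4) * jacobiTheta₂ (z + τ / 2) τ

def parityEquiv : (ℤ × ℤ) ⊕ (ℤ × ℤ) ≃ ℤ × ℤ where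
  toFun p := match p with
    | Sum.inl p => (p.1 + p.2, p.1 - p.2)
    | Sum.inr p => (p.1 + p.2 + 1, p.1 - p.2)
  invFun p := if (p.1 + p.2) % 2 = 0 then Sum.inl ((p.1 + p.2) / 2, (p.1 - p.2) / 2)
    else Sum.inr ((p.1 + p.2) / 2, (p.1 - p.2) / 2)
  left_inv p := by
    rcases p with ⟨a, b⟩ | ⟨a, b⟩
    · have : (a + b + (a - b)) % 2 = 0 := by omega
      simp only [this, if_true, Sum.inl.injEq, Prod.mk.injEq]
      omega
    · have : ¬ (a + b + 1 + (a - b)) % 2 = 0 := by omega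
      simp only [this, if_false, Sum.inr.injEq, Prod.mk.injEq]
      omega
  right_inv p := by
    rcases p with ⟨a, b⟩
    by_cases h : (a + b) % 2 = 0
    · simp only [h, if_true, Prod.mk.injEq]
      omega
    · simp only [h, if_false, Prod.mk.injEq]
      omega

lemma hasSum_thB (z : ℂ) {τ : ℂ} (hτ : 0 < τ.im) :
    HasSum (fun n : ℤ => cexp (2 * Real.pi * I * (n + 1 / 2) * z
      + Real.pi * I * (n + 1 / 2) ^ 2 * τ)) (thB z τ) := by
  have h := (hasSum_jacobiTheta₂_term (z + τ / 2) hτ).mul_left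
    (cexp (Real.pi * I * z + Real.pi * I * τ / 4))
  refine h.congr_fun fun n => ?_
  rw [jacobiTheta₂_term, ← Complex.exp_add]
  congr 1
  ring

lemma hasSum_parity {f : ℤ × ℤ → ℂ} {a b c : ℂ} (hf : HasSum f c)
    (h1 : HasSum (fun p : ℤ × ℤ => f (p.1 + p.2, p.1 - p.2)) a)
    (h2 : HasSum (fun p : ℤ × ℤ => f (p.1 + p.2 + 1, p.1 - p.2)) b) : c = a + b := by
  have hq : HasSum (f ∘ parityEquiv) c := parityEquiv.hasSum_iff.mpr hf
  have hr : HasSum (f ∘ parityEquiv) (a + b) := HasSum.sum h1 h2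
  exact hq.unique hr

lemma term_even (x y τ : ℂ) (j k : ℤ) :
    jacobiTheta₂_term (j + k) x τ * jacobiTheta₂_term (j - k) y τ =
    jacobiTheta₂_term j (x + y) (2 * τ) * jacobiTheta₂_term k (x - y) (2 * τ) := by
  simp only [jacobiTheta₂_term, ← Complex.exp_add]
  congr 1
  push_cast
  ring

lemma term_odd (x y τ : ℂ) (j k : ℤ) :
    jacobiTheta₂_term (j + k + 1) x τ * jacobiTheta₂_term (j - k) y τ =
    cexp (2 * Real.pi * I * (j + 1 / 2) * (x + y) + Real.pi * I * (j + 1 / 2) ^ 2 * (2 * τ)) *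
    cexp (2 * Real.pi * I * (k + 1 / 2) * (x - y) + Real.pi * I * (k + 1 / 2) ^ 2 * (2 * τ)) := by
  simp only [jacobiTheta₂_term, ← Complex.exp_add]
  congr 1
  push_cast
  ring

lemma hasSum_mul_norm {f g : ℤ → ℂ} {a b : ℂ} (hf : HasSum f a) (hg : HasSum g b) :
    HasSum (fun p : ℤ × ℤ => f p.1 * g p.2) (a * b) :=
  hf.mul hg (summable_mul_of_summable_norm hf.summable.norm hg.summable.norm)

lemma thA_mul (x y : ℂ) {τ : ℂ} (hτ : 0 < τ.im) :
    jacobiTheta₂ x τ * jacobiTheta₂ y τ =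
      jacobiTheta₂ (x + y) (2 * τ) * jacobiTheta₂ (x - y) (2 * τ)
      + thB (x + y) (2 * τ) * thB (x - y) (2 * τ) := by
  have h2 : 0 < (2 * τ).im := by simpa using hτ
  have hp := hasSum_mul_norm (hasSum_jacobiTheta₂_term x hτ) (hasSum_jacobiTheta₂_term y hτ)
  have h1 := hasSum_mul_norm (hasSum_jacobiTheta₂_term (x + y) h2)
    (hasSum_jacobiTheta₂_term (x - y) h2)
  have h3 := hasSum_mul_norm (hasSum_thB (x + y) h2) (hasSum_thB (x - y) h2)
  exact hasSum_parity hp (h1.congr_fun fun p => term_even x y τ p.1 p.2)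
    (h3.congr_fun fun p => term_odd x y τ p.1 p.2)

lemma thB_mul (x y : ℂ) {τ : ℂ} (hτ : 0 < τ.im) :
    thB x τ * thB y τ = thB (x + y) (2 * τ) * jacobiTheta₂ (x - y) (2 * τ)
      + jacobiTheta₂ (x + y) (2 * τ) * thB (x - y) (2 * τ) := by
  have h := thA_mul (x + τ / 2) (y + τ / 2) hτ
  have e1 : x + τ / 2 + (y + τ / 2) = (x + y) + τ := by ring
  have e2 : x + τ / 2 - (y + τ / 2) = x - y := by ring
  rw [e1, e2] at h
  have h1 : thB (x + y) (2 * τ) = cexp (Real.pi * I * (x + y) + Real.pi * I * τ / 2) *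
      jacobiTheta₂ (x + y + τ) (2 * τ) := by
    rw [thB]; congr 2 <;> ring
  have h2 : jacobiTheta₂ (x + y) (2 * τ) = cexp (Real.pi * I * (x + y) + Real.pi * I * τ / 2) *
      thB (x + y + τ) (2 * τ) := by
    rw [thB, show x + y + τ + 2 * τ / 2 = (x + y) + 2 * τ by ring, jacobiTheta₂_add_left',
      ← mul_assoc, ← mul_assoc, ← Complex.exp_add, ← Complex.exp_add]
    rw [show ∀ a b c : ℂ, a + (b + c) = a + b + c from fun a b c => by ring]
    ring_nf
    simp
  rw [h1, h2]
  have : thB x τ * thB y τ = cexp (Real.pi * I * (x + y) + Real.pi * I * τ / 2) *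
      (jacobiTheta₂ (x + τ / 2) τ * jacobiTheta₂ (y + τ / 2) τ) := by
    have he : cexp (Real.pi * I * (x + y) + Real.pi * I * τ / 2) =
        cexp (Real.pi * I * x + Real.pi * I * τ / 4) *
          cexp (Real.pi * I * y + Real.pi * I * τ / 4) := by
      rw [← Complex.exp_add]
      congr 1
      ring
    rw [thB, thB, he]
    ring
  rw [this, h]
  ring

lemma thB_add_one (z τ : ℂ) : thB (z + 1) τ = - thB z τ := by
  rw [thB, thB, show z + 1 + τ / 2 = z + τ / 2 + 1 by ring, jacobiTheta₂_add_left,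
    show Real.pi * I * (z + 1) + Real.pi * I * τ / 4 =
      (Real.pi * I * z + Real.pi * I * τ / 4) + Real.pi * I by ring, Complex.exp_add,
      Complex.exp_pi_mul_I]
  ring

lemma thB_neg (z τ : ℂ) : thB (-z) τ = thB z τ := by
  rw [thB, thB, show z + τ / 2 = (z - τ / 2) + τ by ring, jacobiTheta₂_add_left',
    ← jacobiTheta₂_neg_left, show -(-z + τ / 2) = z - τ / 2 by ring, ← mul_assoc,
    ← Complex.exp_add]
  congr 2
  ring

lemma thB_half (τ : ℂ) : thB (1 / 2) τ = 0 := by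
  have h1 := thB_add_one (-(1 / 2)) τ
  rw [thB_neg] at h1
  norm_num at h1
  have h1 : thB (1 / 2) τ = - thB (1 / 2) τ := by simpa using h1
  exact self_eq_neg.mp h1

lemma thB_functional (z : ℂ) {τ : ℂ} (hτ : τ ≠ 0) :
    thB z τ = 1 / (-I * τ) ^ (1 / 2 : ℂ) * cexp (-Real.pi * I * z ^ 2 / τ) *
      jacobiTheta₂ (z / τ + 1 / 2) (-1 / τ) := by
  rw [thB, jacobiTheta₂_functional_equation, show (z + τ / 2) / τ = z / τ + 1 / 2 by field_simp]
  have : cexp (-Real.pi * I * z ^ 2 / τ) = cexp (Real.pi * I * z + Real.pi * I * τ / 4) *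
    cexp (-Real.pi * I * (z + τ / 2) ^ 2 / τ) := by
    rw [← Complex.exp_add]
    congr 1
    field_simp
    ring
  rw [this]
  ring

noncomputable def T3 (x t : ℝ) : ℝ := (jacobiTheta₂ x (I * t)).re
noncomputable def T2 (x t : ℝ) : ℝ := (thB x (I * t)).re

lemma im_I_mul (t : ℝ) : (I * (t : ℂ)).im = t := by simp

lemma ofReal_T3 (x t : ℝ) : (T3 x t : ℂ) = jacobiTheta₂ x (I * t) := by
  have h := jacobiTheta₂_conj x (I * t)
  have : -(starRingEnd ℂ) (I * t) = I * t := by simp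
  rw [this, Complex.conj_ofReal] at h
  exact Complex.conj_eq_iff_re.mp h

lemma ofReal_T2 (x t : ℝ) : (T2 x t : ℂ) = thB x (I * t) := by
  apply Complex.conj_eq_iff_re.mp
  have key : (starRingEnd ℂ) (thB x (I * t)) = thB (-x) (I * t) := by
    rw [thB, thB, map_mul, jacobiTheta₂_conj, ← Complex.exp_conj]
    have h1 : -(starRingEnd ℂ) (I * t) = I * t := by simp
    rw [h1, ← jacobiTheta₂_neg_left (-(x : ℂ) + I * t / 2)]
    congr 2
    · simp [Complex.conj_ofReal, map_ofNat]
    · simp [Complex.conj_ofReal, map_ofNat]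
      ring
  rw [key, thB_neg]

lemma two_mul_I (t : ℝ) : 2 * (I * (t : ℂ)) = I * ((2 * t : ℝ) : ℂ) := by push_cast; ring

lemma T3_mul (x y : ℝ) {t : ℝ} (ht : 0 < t) : T3 x t * T3 y t =
    T3 (x + y) (2 * t) * T3 (x - y) (2 * t) + T2 (x + y) (2 * t) * T2 (x - y) (2 * t) := by
  have h := thA_mul x y (τ := I * t) (by simpa using ht)
  rw [two_mul_I] at h
  apply Complex.ofReal_injective
  push_cast
  simp only [ofReal_T3, ofReal_T2]
  push_cast at h ⊢
  exact h

lemma T2_mul (x y : ℝ) {t : ℝ} (ht : 0 < t) : T2 x t * T2 y t =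
    T2 (x + y) (2 * t) * T3 (x - y) (2 * t) + T3 (x + y) (2 * t) * T2 (x - y) (2 * t) := by
  have h := thB_mul x y (τ := I * t) (by simpa using ht)
  rw [two_mul_I] at h
  apply Complex.ofReal_injective
  push_cast
  simp only [ofReal_T3, ofReal_T2]
  push_cast at h ⊢
  exact h

lemma T3_add_one (x t : ℝ) : T3 (x + 1) t = T3 x t := by
  have := jacobiTheta₂_add_left x (I * t)
  simp only [T3]; push_cast; rw [this]

lemma T2_add_one (x t : ℝ) : T2 (x + 1) t = - T2 x t := by
  have := thB_add_one x (I * t)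
  simp only [T2]; push_cast; rw [this]; simp

lemma T3_neg (x t : ℝ) : T3 (-x) t = T3 x t := by
  have := jacobiTheta₂_neg_left x (I * t)
  simp only [T3]; push_cast; rw [this]

lemma T2_neg (x t : ℝ) : T2 (-x) t = T2 x t := by
  have := thB_neg x (I * t)
  simp only [T2]; push_cast; rw [this]

lemma T2_half (t : ℝ) : T2 (1 / 2) t = 0 := by
  have := thB_half (I * t)
  simp only [T2]; push_cast; rw [this]; simp

lemma T3_pos (x : ℝ) {t : ℝ} (ht : 0 < t) : 0 < T3 x t := by
  have h1 : T3 x t = HurwitzZeta.cosKernel x t := by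
    apply Complex.ofReal_injective
    rw [ofReal_T3, HurwitzZeta.cosKernel_def]
  have h2 := HurwitzZeta.evenKernel_functional_equation x (1 / t)
  rw [one_div_one_div, ← h1] at h2
  have h3 := HurwitzZeta.hasSum_int_evenKernel x (t := 1 / t) (by positivity)
  have h4 : 0 < HurwitzZeta.evenKernel x (1 / t) := by
    rw [← h3.tsum_eq]
    exact h3.summable.tsum_pos (fun _ => (Real.exp_pos _).le) 0 (Real.exp_pos _)
  rw [h2] at h4
  exact (mul_pos_iff_of_pos_left (by positivity)).mp h4

noncomputable def thG (h y s : ℝ) : ℝ := (jacobiTheta₂ (h + I * (y * s)) (I * s)).re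

lemma T3_functional (x : ℝ) {t : ℝ} (ht : 0 < t) : T3 x t =
    1 / Real.sqrt t * Real.exp (-Real.pi * x ^ 2 / t) * thG 0 (-x) (1 / t) := by
  have h0 : (t : ℂ) ≠ 0 := by exact_mod_cast ht.ne'
  have h := jacobiTheta₂_functional_equation x (I * t)
  have e1 : -I * (I * (t : ℂ)) = t := by rw [← mul_assoc]; simp
  have e2 : ((t : ℂ)) ^ (1 / 2 : ℂ) = ((Real.sqrt t : ℝ) : ℂ) := by
    rw [Real.sqrt_eq_rpow, Complex.ofReal_cpow ht.le]; norm_num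
  have e3 : -(Real.pi : ℂ) * I * x ^ 2 / (I * t) = ((-Real.pi * x ^ 2 / t : ℝ) : ℂ) := by
    push_cast; field_simp
  have e4 : (x : ℂ) / (I * t) = (0 : ℝ) + I * (((-x : ℝ) : ℂ) * ((1 / t : ℝ) : ℂ)) := by
    push_cast; field_simp; simp; linear_combination (x : ℂ) * I_sq
  have e5 : -1 / (I * (t : ℂ)) = I * ((1 / t : ℝ) : ℂ) := by
    push_cast; field_simp; simp
  rw [e1, e2, e3, e4, e5, ← Complex.ofReal_exp] at h
  rw [T3, h, thG, ← Complex.ofReal_one, ← Complex.ofReal_div, ← Complex.ofReal_mul,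
    Complex.re_ofReal_mul]

lemma T2_functional (x : ℝ) {t : ℝ} (ht : 0 < t) : T2 x t =
    1 / Real.sqrt t * Real.exp (-Real.pi * x ^ 2 / t) * thG (1 / 2) (-x) (1 / t) := by
  have h0 : (t : ℂ) ≠ 0 := by exact_mod_cast ht.ne'
  have h := thB_functional x (τ := I * t) (by simp [h0])
  have e1 : -I * (I * (t : ℂ)) = t := by rw [← mul_assoc]; simp
  have e2 : ((t : ℂ)) ^ (1 / 2 : ℂ) = ((Real.sqrt t : ℝ) : ℂ) := by
    rw [Real.sqrt_eq_rpow, Complex.ofReal_cpow ht.le]; norm_num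
  have e3 : -(Real.pi : ℂ) * I * x ^ 2 / (I * t) = ((-Real.pi * x ^ 2 / t : ℝ) : ℂ) := by
    push_cast; field_simp
  have e4 : (x : ℂ) / (I * t) + 1 / 2 =
      ((1 / 2 : ℝ) : ℂ) + I * (((-x : ℝ) : ℂ) * ((1 / t : ℝ) : ℂ)) := by
    rw [add_comm]; congr 1
    · push_cast; rfl
    · push_cast; field_simp; simp
  have e5 : -1 / (I * (t : ℂ)) = I * ((1 / t : ℝ) : ℂ) := by
    push_cast; field_simp; simp
  rw [e1, e2, e3, e4, e5, ← Complex.ofReal_exp] at h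
  rw [T2, h, thG, ← Complex.ofReal_one, ← Complex.ofReal_div, ← Complex.ofReal_mul,
    Complex.re_ofReal_mul]

lemma thG_zero (h s : ℝ) : thG h 0 s = T3 h s := by simp [thG, T3]

lemma tendsto_thG (h y : ℝ) (hy : |y| ≤ 1 / 2) :
    Tendsto (fun s : ℝ => jacobiTheta₂ (h + I * (y * s)) (I * s)) atTop
      (nhds (∑' n : ℤ, if (n : ℝ) ^ 2 + 2 * n * y = 0 then cexp (2 * Real.pi * I * n * h) else 0)) := by
  have hnn : ∀ n : ℤ, 0 ≤ (n : ℝ) ^ 2 + 2 * n * y := by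
    intro n
    have h1 : |(n : ℝ)| ≤ (n : ℝ) ^ 2 := by
      rw [← sq_abs]
      by_cases hn : n = 0
      · simp [hn]
      · have : (1 : ℝ) ≤ |(n : ℝ)| := by exact_mod_cast Int.one_le_abs hn
        nlinarith
    have h2 : |2 * n * y| ≤ |(n : ℝ)| := by
      rw [abs_mul, abs_mul, abs_two]
      nlinarith [abs_nonneg (n : ℝ)]
    linarith [neg_abs_le (2 * n * y)]
  have hnorm : ∀ (n : ℤ) (s : ℝ), ‖jacobiTheta₂_term n (h + I * (y * s)) (I * s)‖ =
      Real.exp (-Real.pi * s * ((n : ℝ) ^ 2 + 2 * n * y)) := by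
    intro n s
    rw [norm_jacobiTheta₂_term]
    congr 1
    simp
    ring
  unfold jacobiTheta₂
  refine tendsto_tsum_of_dominated_convergence
    (bound := fun n : ℤ => ‖jacobiTheta₂_term n (h + I * (y * (1 : ℝ))) (I * (1 : ℝ))‖) ?_ ?_ ?_
  · exact ((summable_jacobiTheta₂_term_iff _ _).mpr (by simp)).norm
  · intro n
    split_ifs with hn
    · have : ∀ s : ℝ, jacobiTheta₂_term n (h + I * (y * s)) (I * s) =
          cexp (2 * Real.pi * I * n * h) := by
        intro s
        have hn' : (n : ℂ) ^ 2 + 2 * n * y = 0 := by exact_mod_cast hn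
        rw [jacobiTheta₂_term]
        congr 1
        linear_combination (Real.pi * s * I ^ 2 : ℂ) * hn'
      simp only [this]
      exact tendsto_const_nhds
    · rw [tendsto_zero_iff_norm_tendsto_zero]
      simp only [hnorm]
      have hpos := lt_of_le_of_ne (hnn n) (Ne.symm hn)
      have : Tendsto (fun s : ℝ => -(s * (Real.pi * ((n : ℝ) ^ 2 + 2 * n * y)))) atTop atBot :=
        tendsto_neg_atTop_atBot.comp (tendsto_id.atTop_mul_const (by positivity))
      refine (Real.tendsto_exp_atBot.comp this).congr fun s => ?_
      simp only [Function.comp]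
      congr 1
      ring
  · filter_upwards [eventually_ge_atTop (1 : ℝ)] with s hs n
    rw [hnorm, hnorm, Real.exp_le_exp]
    have := mul_nonneg Real.pi_pos.le (hnn n)
    nlinarith

lemma tendsto_thG_one (h y : ℝ) (hy : |y| < 1 / 2) :
    Tendsto (fun s : ℝ => thG h y s) atTop (nhds 1) := by
  have h1 := tendsto_thG h y hy.le
  have h2 : (∑' n : ℤ, if (n : ℝ) ^ 2 + 2 * n * y = 0 then cexp (2 * Real.pi * I * n * h) else 0)
      = 1 := by
    rw [tsum_eq_single 0]
    · simp
    · intro n hn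
      rw [if_neg]
      intro h0
      have : (n : ℝ) ≠ 0 := by exact_mod_cast hn
      have h3 : (n : ℝ) + 2 * y = 0 := by
        apply mul_left_cancel₀ this
        linarith
      have h4 : (1 : ℝ) ≤ |(n : ℝ)| := by exact_mod_cast Int.one_le_abs hn
      rw [show (n : ℝ) = -(2 * y) by linarith, abs_neg, abs_mul, abs_two] at h4
      linarith
  rw [h2] at h1
  have h5 := (Complex.continuous_re.tendsto _).comp h1
  rw [Complex.one_re] at h5
  exact h5

lemma tendsto_T3 (x : ℝ) : Tendsto (fun t => T3 x t) atTop (nhds 1) := by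
  have := tendsto_thG_one x 0 (by simp)
  simpa only [thG_zero] using this

lemma tendsto_T2 (x : ℝ) : Tendsto (fun t => Real.exp (Real.pi * t / 4) * T2 x t) atTop
    (nhds (2 * Real.cos (Real.pi * x))) := by
  have h1 := tendsto_thG x (1 / 2) (by norm_num [abs_of_pos])
  have h2 : (∑' n : ℤ, if (n : ℝ) ^ 2 + 2 * n * (1 / 2 : ℝ) = 0 then
      cexp (2 * Real.pi * I * n * x) else 0) = 1 + cexp (-2 * Real.pi * I * x) := by
    rw [tsum_eq_sum (s := {0, -1})]
    · rw [Finset.sum_pair (by norm_num)]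
      norm_num
    · intro n hn
      rw [if_neg]
      intro h0
      have h3 : (n : ℝ) * (n + 1) = 0 := by linarith
      have h4 : n * (n + 1) = 0 := by exact_mod_cast h3
      simp only [Finset.mem_insert, Finset.mem_singleton, not_or] at hn
      rcases mul_eq_zero.mp h4 with h | h
      · exact hn.1 h
      · exact hn.2 (by omega)
  rw [h2] at h1
  have h3 := h1.const_mul (cexp (Real.pi * I * x))
  have h4 : cexp (Real.pi * I * x) * (1 + cexp (-2 * Real.pi * I * x)) =
      ((2 * Real.cos (Real.pi * x) : ℝ) : ℂ) := by
    push_cast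
    rw [Complex.cos, mul_add, ← Complex.exp_add]
    ring_nf
  rw [h4] at h3
  have h5 := (Complex.continuous_re.tendsto _).comp h3
  rw [Complex.ofReal_re] at h5
  refine h5.congr fun t => ?_
  simp only [Function.comp]
  have : cexp (Real.pi * I * x) * jacobiTheta₂ (x + I * ((1 / 2 : ℝ) * t)) (I * t) =
      ((Real.exp (Real.pi * t / 4) * T2 x t : ℝ) : ℂ) := by
    push_cast
    rw [ofReal_T2, thB, ← mul_assoc (cexp _) (cexp _), ← Complex.exp_add]
    congr 2
    · linear_combination (-(Real.pi * t / 4) : ℂ) * I_sq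
    · ring
  rw [this, Complex.ofReal_re]

lemma T2_zero_pos {t : ℝ} (ht : 0 < t) : 0 < T2 0 t := by
  rw [T2_functional 0 ht]
  have := T3_pos (1 / 2) (t := 1 / t) (by positivity)
  rw [neg_zero, thG_zero]
  positivity

lemma T2_pos {x : ℝ} (hx : |x| < 1 / 2) {t : ℝ} (ht : 0 < t) : 0 < T2 x t := by
  have hc : 0 < Real.cos (Real.pi * x) := by
    rw [abs_lt] at hx
    apply Real.cos_pos_of_mem_Ioo
    constructor <;> nlinarith [Real.pi_pos]
  have hev : ∀ᶠ t in atTop, 0 < T2 x t := by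
    filter_upwards [(tendsto_T2 x).eventually (lt_mem_nhds (by positivity : 0 < 2 * Real.cos (Real.pi * x)))]
      with t h
    exact (mul_pos_iff_of_pos_left (Real.exp_pos _)).mp h
  have hstep : ∀ t, 0 < t → 0 < T2 x (2 * t) → 0 < T2 x t := by
    intro t ht h
    have h1 := T2_mul x 0 ht
    simp only [add_zero, sub_zero] at h1
    have h2 := T3_pos x (t := 2 * t) (by positivity)
    have h3 := T2_zero_pos ht
    have h4 : 0 < T2 x t * T2 0 t := by rw [h1]; positivity
    exact (mul_pos_iff_of_pos_right h3).mp h4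
  have hlim : Tendsto (fun n : ℕ => 2 ^ n * t) atTop atTop :=
    (tendsto_pow_atTop_atTop_of_one_lt one_lt_two).atTop_mul_const ht
  obtain ⟨n, hn⟩ := (hlim.eventually hev).exists
  induction n with
  | zero => simpa using hn
  | succ k ih =>
    apply ih
    apply hstep _ (by positivity)
    rw [← mul_assoc, ← pow_succ']
    exact hn

lemma continuousAt_T3 (x : ℝ) {t : ℝ} (ht : 0 < t) : ContinuousAt (fun t => T3 x t) t := by
  have h := continuousAt_jacobiTheta₂ (x : ℂ) (τ := I * t) (by simpa using ht)
  have h2 : ContinuousAt (fun t : ℝ => ((x : ℂ), I * (t : ℂ))) t := by fun_prop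
  exact Complex.continuous_re.continuousAt.comp (ContinuousAt.comp (f := fun t : ℝ => ((x : ℂ), I * (t : ℂ))) h h2)

lemma continuousAt_T2 (x : ℝ) {t : ℝ} (ht : 0 < t) : ContinuousAt (fun t => T2 x t) t := by
  have h := continuousAt_jacobiTheta₂ ((x : ℂ) + I * t / 2) (τ := I * t) (by simpa using ht)
  have h2 : ContinuousAt (fun t : ℝ => ((x : ℂ) + I * t / 2, I * (t : ℂ))) t := by fun_prop
  have h3 := ContinuousAt.comp (f := fun t : ℝ => ((x : ℂ) + I * t / 2, I * (t : ℂ))) h h2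
  have h4 : ContinuousAt (fun t : ℝ => cexp (Real.pi * I * x + Real.pi * I * (I * t) / 4)) t := by
    fun_prop
  exact Complex.continuous_re.continuousAt.comp (h4.mul h3)

open MeasureTheory in
noncomputable def agmJ (a b : ℝ) : ℝ :=
  ∫ y in Ioi (0 : ℝ), 1 / Real.sqrt ((y ^ 2 + a ^ 2) * (y ^ 2 + b ^ 2))

lemma ellK_ofReal {m : ℝ} (hm : m ≤ 1) : ellK m =
    ((∫ t in (0 : ℝ)..1, 1 / Real.sqrt ((1 - t ^ 2) * (1 - m * t ^ 2)) : ℝ) : ℂ) := by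
  rw [ellK, ← intervalIntegral.integral_ofReal]
  apply intervalIntegral.integral_congr
  intro t ht
  rw [uIcc_of_le zero_le_one] at ht
  have h1 : 0 ≤ 1 - t ^ 2 := by nlinarith [ht.1, ht.2]
  have h2 : 0 ≤ 1 - m * t ^ 2 := by nlinarith [ht.1, ht.2, sq_nonneg t]
  have h3 : 0 ≤ (1 - t ^ 2) * (1 - m * t ^ 2) := mul_nonneg h1 h2
  simp only
  rw [Real.sqrt_eq_rpow]
  push_cast
  rw [Complex.ofReal_cpow h3]
  push_cast
  rfl

lemma hasDerivAt_cov (y : ℝ) : HasDerivAt (fun y : ℝ => (Real.sqrt (1 + y ^ 2))⁻¹)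
    (-(y / Real.sqrt (1 + y ^ 2)) / (1 + y ^ 2)) y := by
  have h0 : 0 < 1 + y ^ 2 := by positivity
  have h1 : HasDerivAt (fun y : ℝ => 1 + y ^ 2) (2 * y) y := by
    simpa using (hasDerivAt_pow 2 y).const_add 1
  have h2 := (h1.sqrt h0.ne').inv (Real.sqrt_pos.mpr h0).ne'
  rw [Real.sq_sqrt h0.le] at h2
  have h3 : 2 * y / (2 * Real.sqrt (1 + y ^ 2)) = y / Real.sqrt (1 + y ^ 2) := by
    rw [mul_div_mul_left _ _ two_ne_zero]
  rw [h3] at h2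
  exact h2

lemma image_cov : Set.image (fun y : ℝ => (Real.sqrt (1 + y ^ 2))⁻¹) (Ioi 0) = Ioo 0 1 := by
  ext t
  simp only [mem_image, mem_Ioi, mem_Ioo]
  constructor
  · rintro ⟨y, hy, rfl⟩
    have h1 : 1 < Real.sqrt (1 + y ^ 2) := by
      rw [Real.lt_sqrt (by norm_num)]
      nlinarith
    exact ⟨by positivity, inv_lt_one_of_one_lt₀ h1⟩
  · rintro ⟨h0, h1⟩
    have h2 : 1 < (t ^ 2)⁻¹ := (one_lt_inv₀ (by positivity)).mpr (by nlinarith)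
    refine ⟨Real.sqrt ((t ^ 2)⁻¹ - 1), Real.sqrt_pos.mpr (by linarith), ?_⟩
    rw [Real.sq_sqrt (by linarith), add_sub_cancel, Real.sqrt_inv, Real.sqrt_sq h0.le, inv_inv]

lemma injOn_cov : InjOn (fun y : ℝ => (Real.sqrt (1 + y ^ 2))⁻¹) (Ioi 0) := by
  intro a ha b hb h
  have ha' : 0 < a := ha
  have hb' : 0 < b := hb
  have h1 := inv_injective h
  rw [Real.sqrt_inj (by positivity) (by positivity)] at h1
  have h2 : a ^ 2 = b ^ 2 := by linarith
  exact (pow_left_inj₀ ha'.le hb'.le (by norm_num)).mp h2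

lemma integral_eq_agmJ {m b : ℝ} (hb : b ^ 2 = 1 - m) :
    ∫ t in (0 : ℝ)..1, 1 / Real.sqrt ((1 - t ^ 2) * (1 - m * t ^ 2)) = agmJ 1 b := by
  rw [intervalIntegral.integral_of_le zero_le_one, MeasureTheory.integral_Ioc_eq_integral_Ioo,
    ← image_cov, MeasureTheory.integral_image_eq_integral_abs_deriv_smul measurableSet_Ioi
      (fun y _ => (hasDerivAt_cov y).hasDerivWithinAt) injOn_cov, agmJ]
  apply MeasureTheory.setIntegral_congr_fun measurableSet_Ioi
  intro y hy
  have hy' : 0 < y := hy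
  have hw : 0 < 1 + y ^ 2 := by positivity
  have hs : 0 < Real.sqrt (1 + y ^ 2) := Real.sqrt_pos.mpr hw
  have hv : 0 < y ^ 2 + b ^ 2 := by positivity
  have hvs : 0 < Real.sqrt (y ^ 2 + b ^ 2) := Real.sqrt_pos.mpr hv
  simp only [smul_eq_mul]
  have e1 : (1 - (Real.sqrt (1 + y ^ 2))⁻¹ ^ 2) * (1 - m * (Real.sqrt (1 + y ^ 2))⁻¹ ^ 2) =
      (y / (1 + y ^ 2)) ^ 2 * (y ^ 2 + b ^ 2) := by
    rw [inv_pow, Real.sq_sqrt hw.le, hb]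
    field_simp
    ring
  rw [e1, Real.sqrt_mul (by positivity), Real.sqrt_sq (by positivity), one_pow,
    add_comm (y ^ 2) 1, Real.sqrt_mul hw.le, abs_div, abs_neg, abs_of_pos hw,
    abs_of_pos (by positivity)]
  field_simp

lemma agmJ_homog {a b c : ℝ} (hc : 0 < c) : agmJ (c * a) (c * b) = agmJ a b / c := by
  have h := MeasureTheory.integral_comp_mul_left_Ioi
    (fun y : ℝ => 1 / Real.sqrt ((y ^ 2 + (c * a) ^ 2) * (y ^ 2 + (c * b) ^ 2))) 0 hc
  rw [mul_zero] at h
  have h1 : ∀ y : ℝ, 1 / Real.sqrt (((c * y) ^ 2 + (c * a) ^ 2) * ((c * y) ^ 2 + (c * b) ^ 2)) =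
      (c ^ 2)⁻¹ * (1 / Real.sqrt ((y ^ 2 + a ^ 2) * (y ^ 2 + b ^ 2))) := by
    intro y
    rw [show ((c * y) ^ 2 + (c * a) ^ 2) * ((c * y) ^ 2 + (c * b) ^ 2) =
      (c ^ 2) ^ 2 * ((y ^ 2 + a ^ 2) * (y ^ 2 + b ^ 2)) by ring,
      Real.sqrt_mul (by positivity), Real.sqrt_sq (by positivity)]
    rw [one_div, one_div, mul_inv]
  simp only [h1, MeasureTheory.integral_const_mul, smul_eq_mul] at h
  rw [← agmJ, ← agmJ] at h
  field_simp at h ⊢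
  linarith

lemma hasDerivAt_gauss (p : ℝ) {x : ℝ} (hx : 0 < x) : HasDerivAt (fun x : ℝ => (x - p / x) / 2)
    ((x ^ 2 + p) / (2 * x ^ 2)) x := by
  have h := ((hasDerivAt_id x).sub ((hasDerivAt_const x p).div (hasDerivAt_id x) hx.ne')).div_const 2
  have e : (1 - (0 * id x - p * 1) / id x ^ 2) / 2 = (x ^ 2 + p) / (2 * x ^ 2) := by
    simp only [id]
    field_simp
    ring
  rw [e] at h
  exact h

lemma injOn_gauss {p : ℝ} (hp : 0 < p) : InjOn (fun x : ℝ => (x - p / x) / 2) (Ioi 0) := by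
  intro a ha b hb h
  have ha' : 0 < a := ha
  have hb' : 0 < b := hb
  change (a - p / a) / 2 = (b - p / b) / 2 at h
  have h1 : a - p / a = b - p / b := by linarith
  field_simp at h1
  have h2 : (a - b) * (a * b + p) = 0 := by linarith
  rcases mul_eq_zero.mp h2 with h3 | h3
  · linarith
  · nlinarith [mul_pos ha' hb']

lemma image_gauss {p : ℝ} (hp : 0 < p) : Set.image (fun x : ℝ => (x - p / x) / 2) (Ioi 0) = univ := by
  rw [eq_univ_iff_forall]
  intro t
  have h1 : 0 ≤ t ^ 2 + p := by positivity
  have h2 : |t| < Real.sqrt (t ^ 2 + p) := by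
    rw [Real.lt_sqrt (abs_nonneg _), sq_abs]; linarith
  have h3 : 0 < t + Real.sqrt (t ^ 2 + p) := by linarith [neg_abs_le t]
  refine ⟨t + Real.sqrt (t ^ 2 + p), h3, ?_⟩
  simp only
  field_simp
  linarith [Real.sq_sqrt h1]

lemma agmJ_gauss {a b B : ℝ} (ha : 0 < a) (hb : 0 < b) (hB : B ^ 2 = a * b) :
    agmJ ((a + b) / 2) B = agmJ a b := by
  have hp : 0 < a * b := mul_pos ha hb
  have h1 := integral_comp_abs (f := fun y : ℝ =>
    1 / Real.sqrt ((y ^ 2 + ((a + b) / 2) ^ 2) * (y ^ 2 + B ^ 2)))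
  simp only [sq_abs] at h1
  rw [← agmJ, ← MeasureTheory.setIntegral_univ, ← image_gauss hp,
    MeasureTheory.integral_image_eq_integral_abs_deriv_smul measurableSet_Ioi
      (fun y hy => (hasDerivAt_gauss (a * b) hy).hasDerivWithinAt) (injOn_gauss hp)] at h1
  have h2 : ∫ x in Ioi (0 : ℝ), |(x ^ 2 + a * b) / (2 * x ^ 2)| •
      (1 / Real.sqrt ((((x - a * b / x) / 2) ^ 2 + ((a + b) / 2) ^ 2) *
        (((x - a * b / x) / 2) ^ 2 + B ^ 2))) =
      ∫ x in Ioi (0 : ℝ), 2 * (1 / Real.sqrt ((x ^ 2 + a ^ 2) * (x ^ 2 + b ^ 2))) := by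
    apply MeasureTheory.setIntegral_congr_fun measurableSet_Ioi
    intro x hx
    have hx' : 0 < x := hx
    have e : (((x - a * b / x) / 2) ^ 2 + ((a + b) / 2) ^ 2) *
        (((x - a * b / x) / 2) ^ 2 + B ^ 2) =
        ((x ^ 2 + a * b) / (4 * x ^ 2)) ^ 2 * ((x ^ 2 + a ^ 2) * (x ^ 2 + b ^ 2)) := by
      rw [hB]
      field_simp
      ring
    simp only [smul_eq_mul]
    have hr : 0 < Real.sqrt ((x ^ 2 + a ^ 2) * (x ^ 2 + b ^ 2)) := Real.sqrt_pos.mpr (by positivity)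
    rw [e, Real.sqrt_mul (by positivity), Real.sqrt_sq (by positivity),
      abs_of_pos (by positivity)]
    field_simp
    norm_num
  rw [h2, MeasureTheory.integral_const_mul, ← agmJ] at h1
  linarith

lemma agmJ_one_one : agmJ 1 1 = Real.pi / 2 := by
  have h := integral_Ioi_inv_one_add_sq (i := 0)
  rw [Real.arctan_zero, sub_zero] at h
  rw [← h, agmJ]
  congr 1
  ext y
  rw [← sq, Real.sqrt_sq (by positivity), one_div]
  congr 1
  ring

lemma tendsto_agmJ {a b : ℕ → ℝ} (ha : Tendsto a atTop (nhds 1)) (hb : Tendsto b atTop (nhds 1)) :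
    Tendsto (fun n => agmJ (a n) (b n)) atTop (nhds (Real.pi / 2)) := by
  rw [← agmJ_one_one]
  unfold agmJ
  apply MeasureTheory.tendsto_integral_filter_of_dominated_convergence
    (fun y : ℝ => 4 * (1 + y ^ 2)⁻¹)
  · refine Eventually.of_forall fun n => Measurable.aestronglyMeasurable ?_
    fun_prop
  · have hha : ∀ᶠ n in atTop, (1 / 2 : ℝ) < a n := ha.eventually (lt_mem_nhds (by norm_num))
    have hhb : ∀ᶠ n in atTop, (1 / 2 : ℝ) < b n := hb.eventually (lt_mem_nhds (by norm_num))
    filter_upwards [hha, hhb] with n h1 h2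
    refine Eventually.of_forall fun y => ?_
    have h3 : (1 + y ^ 2) / 4 ≤ Real.sqrt ((y ^ 2 + a n ^ 2) * (y ^ 2 + b n ^ 2)) := by
      apply Real.le_sqrt_of_sq_le
      rw [sq]
      apply mul_le_mul <;> nlinarith [sq_nonneg y]
    have h4 : 0 < (1 + y ^ 2) / 4 := by positivity
    rw [Real.norm_of_nonneg (by positivity)]
    calc 1 / Real.sqrt ((y ^ 2 + a n ^ 2) * (y ^ 2 + b n ^ 2)) ≤ 1 / ((1 + y ^ 2) / 4) :=
        one_div_le_one_div_of_le h4 h3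
      _ = 4 * (1 + y ^ 2)⁻¹ := by field_simp
  · exact (integrable_inv_one_add_sq.const_mul 4).integrableOn
  · refine Eventually.of_forall fun y => ?_
    apply Tendsto.div tendsto_const_nhds
    · apply (Real.continuous_sqrt.tendsto _).comp
      exact ((ha.pow 2).const_add _).mul ((hb.pow 2).const_add _)
    · exact (Real.sqrt_pos.mpr (by positivity)).ne'

section identities
variable {t : ℝ} (x : ℝ)

lemma T3_sq (ht : 0 < t) : T3 x t ^ 2 = T3 (2 * x) (2 * t) * T3 0 (2 * t)
    + T2 (2 * x) (2 * t) * T2 0 (2 * t) := by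
  rw [sq, T3_mul x x ht, sub_self, ← two_mul]

lemma T4_sq (ht : 0 < t) : T3 (x + 1 / 2) t ^ 2 = T3 (2 * x) (2 * t) * T3 0 (2 * t)
    - T2 (2 * x) (2 * t) * T2 0 (2 * t) := by
  rw [T3_sq _ ht, show 2 * (x + 1 / 2) = 2 * x + 1 by ring, T3_add_one, T2_add_one]
  ring

lemma T2_sq (ht : 0 < t) : T2 x t ^ 2 = T2 (2 * x) (2 * t) * T3 0 (2 * t)
    + T3 (2 * x) (2 * t) * T2 0 (2 * t) := by
  rw [sq, T2_mul x x ht, sub_self, ← two_mul]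

lemma T1_sq (ht : 0 < t) : T2 (x + 1 / 2) t ^ 2 = -(T2 (2 * x) (2 * t) * T3 0 (2 * t))
    + T3 (2 * x) (2 * t) * T2 0 (2 * t) := by
  rw [T2_sq _ ht, show 2 * (x + 1 / 2) = 2 * x + 1 by ring, T3_add_one, T2_add_one]
  ring

lemma T3z_sq (ht : 0 < t) : T3 0 t ^ 2 = T3 0 (2 * t) ^ 2 + T2 0 (2 * t) ^ 2 := by
  rw [T3_sq 0 ht, mul_zero]; ring

lemma T4z_sq (ht : 0 < t) : T3 (1 / 2) t ^ 2 = T3 0 (2 * t) ^ 2 - T2 0 (2 * t) ^ 2 := by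
  have h := T4_sq 0 ht
  rw [zero_add, mul_zero] at h
  rw [h]; ring

lemma T2z_sq (ht : 0 < t) : T2 0 t ^ 2 = 2 * T3 0 (2 * t) * T2 0 (2 * t) := by
  rw [T2_sq 0 ht, mul_zero]; ring

lemma jacobi_quartic (ht : 0 < t) : T2 0 t ^ 4 + T3 (1 / 2) t ^ 4 = T3 0 t ^ 4 := by
  have h1 := T3z_sq ht
  have h2 := T4z_sq ht
  have h3 := T2z_sq ht
  rw [show T2 0 t ^ 4 = (T2 0 t ^ 2) ^ 2 by ring, show T3 0 t ^ 4 = (T3 0 t ^ 2) ^ 2 by ring,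
    show T3 (1 / 2) t ^ 4 = (T3 (1 / 2) t ^ 2) ^ 2 by ring, h1, h2, h3]
  ring

lemma sn_cn_rel (ht : 0 < t) : T3 0 t ^ 2 * T2 (x + 1 / 2) t ^ 2 + T3 (1 / 2) t ^ 2 * T2 x t ^ 2 =
    T2 0 t ^ 2 * T3 (x + 1 / 2) t ^ 2 := by
  rw [T3z_sq ht, T4z_sq ht, T2z_sq ht, T1_sq x ht, T2_sq x ht, T4_sq x ht]
  ring

lemma sn_dn_rel (ht : 0 < t) : T3 (1 / 2) t ^ 2 * T3 x t ^ 2 + T2 0 t ^ 2 * T2 (x + 1 / 2) t ^ 2 =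
    T3 0 t ^ 2 * T3 (x + 1 / 2) t ^ 2 := by
  rw [T3z_sq ht, T4z_sq ht, T2z_sq ht, T1_sq x ht, T3_sq x ht, T4_sq x ht]
  ring

lemma agm_step1 (ht : 0 < t) : T3 0 (2 * t) ^ 2 = (T3 0 t ^ 2 + T3 (1 / 2) t ^ 2) / 2 := by
  rw [T3z_sq ht, T4z_sq ht]; ring

lemma agm_step2 (ht : 0 < t) : (T3 (1 / 2) (2 * t) ^ 2) ^ 2 = T3 0 t ^ 2 * T3 (1 / 2) t ^ 2 := by
  have h := T3_mul 0 (1 / 2) ht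
  rw [zero_add, zero_sub, T3_neg, T2_half] at h
  rw [← mul_pow, h]
  ring

end identities

lemma agmJ_theta {t : ℝ} (ht : 0 < t) : agmJ (T3 0 t ^ 2) (T3 (1 / 2) t ^ 2) = Real.pi / 2 := by
  have hstep : ∀ n : ℕ, agmJ (T3 0 (2 ^ n * t) ^ 2) (T3 (1 / 2) (2 ^ n * t) ^ 2) =
      agmJ (T3 0 t ^ 2) (T3 (1 / 2) t ^ 2) := by
    intro n
    induction n with
    | zero => simp
    | succ k ih =>
      have hk : 0 < 2 ^ k * t := by positivity
      have e : (2 : ℝ) ^ (k + 1) * t = 2 * (2 ^ k * t) := by ring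
      rw [← ih, e, agm_step1 hk]
      exact agmJ_gauss (pow_pos (T3_pos _ hk) 2) (pow_pos (T3_pos _ hk) 2) (agm_step2 hk)
  have hlim : Tendsto (fun n : ℕ => 2 ^ n * t) atTop atTop :=
    (tendsto_pow_atTop_atTop_of_one_lt one_lt_two).atTop_mul_const ht
  have h1 : Tendsto (fun n : ℕ => T3 0 (2 ^ n * t) ^ 2) atTop (nhds 1) := by
    simpa using ((tendsto_T3 0).comp hlim).pow 2
  have h2 : Tendsto (fun n : ℕ => T3 (1 / 2) (2 ^ n * t) ^ 2) atTop (nhds 1) := by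
    simpa using ((tendsto_T3 (1 / 2)).comp hlim).pow 2
  have h3 := tendsto_agmJ h1 h2
  simp only [hstep] at h3
  exact tendsto_nhds_unique tendsto_const_nhds h3

noncomputable def lam (t : ℝ) : ℝ := 1 - (T3 (1 / 2) t / T3 0 t) ^ 4

lemma lam_eq {t : ℝ} (ht : 0 < t) : lam t = (T2 0 t / T3 0 t) ^ 4 := by
  have h := jacobi_quartic ht
  have h0 := T3_pos 0 ht
  rw [lam, div_pow, div_pow]
  field_simp
  linarith

lemma lam_pos {t : ℝ} (ht : 0 < t) : 0 < lam t := by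
  rw [lam_eq ht]
  have := T3_pos 0 ht
  have := T2_zero_pos ht
  positivity

lemma lam_lt_one {t : ℝ} (ht : 0 < t) : lam t < 1 := by
  have := T3_pos 0 ht
  have := T3_pos (1 / 2) ht
  have : 0 < (T3 (1 / 2) t / T3 0 t) ^ 4 := by positivity
  rw [lam]; linarith

lemma T3_zero_inv {t : ℝ} (ht : 0 < t) : T3 0 (1 / t) = Real.sqrt t * T3 0 t := by
  have h := T3_functional 0 ht
  rw [neg_zero, thG_zero] at h
  have := Real.sqrt_pos.mpr ht
  rw [h]
  field_simp
  simp

lemma T3_half_inv {t : ℝ} (ht : 0 < t) : T3 (1 / 2) (1 / t) = Real.sqrt t * T2 0 t := by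
  have h := T2_functional 0 ht
  rw [neg_zero, thG_zero] at h
  have := Real.sqrt_pos.mpr ht
  rw [h]
  field_simp
  simp

lemma lam_inv {t : ℝ} (ht : 0 < t) : lam (1 / t) = 1 - lam t := by
  have h := Real.sqrt_pos.mpr ht
  rw [lam_eq ht, lam, T3_zero_inv ht, T3_half_inv ht, mul_div_mul_left _ _ h.ne']

lemma ellK_lam {t : ℝ} (ht : 0 < t) : ellK (lam t) = ((Real.pi / 2 * T3 0 t ^ 2 : ℝ) : ℂ) := by
  have h0 := T3_pos 0 ht
  have h1 : ((T3 (1 / 2) t / T3 0 t) ^ 2) ^ 2 = 1 - lam t := by rw [lam]; ring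
  rw [ellK_ofReal (lam_lt_one ht).le, integral_eq_agmJ h1]
  have h2 := agmJ_theta ht
  have h3 := agmJ_homog (a := 1) (b := (T3 (1 / 2) t / T3 0 t) ^ 2) (pow_pos h0 2)
  have h4 : T3 0 t ^ 2 * (T3 (1 / 2) t / T3 0 t) ^ 2 = T3 (1 / 2) t ^ 2 := by field_simp
  rw [mul_one, h4, h2] at h3
  congr 1
  rw [eq_div_iff (pow_pos h0 2).ne'] at h3
  exact h3.symm

lemma KR_lam {t : ℝ} (ht : 0 < t) : KR (lam t) = Real.pi / 2 * T3 0 t ^ 2 := by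
  rw [KR, ellK_lam ht, Complex.ofReal_re]

lemma ratio_lam {t : ℝ} (ht : 0 < t) : KR (1 - lam t) / KR (lam t) = t := by
  have h0 := T3_pos 0 ht
  have hp := Real.pi_pos
  rw [← lam_inv ht, KR_lam ht, KR_lam (by positivity), T3_zero_inv ht, mul_pow, Real.sq_sqrt ht.le]
  field_simp

lemma nome_lam {t : ℝ} (ht : 0 < t) : nome (lam t) = cexp ((-(Real.pi * t) : ℝ) : ℂ) := by
  have h1 : (1 : ℂ) - lam t = ((lam (1 / t) : ℝ) : ℂ) := by rw [lam_inv ht]; push_cast; rfl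
  have h0 := T3_pos 0 ht
  have hp := Real.pi_pos
  rw [nome, h1, ellK_lam ht, ellK_lam (t := 1 / t) (by positivity), T3_zero_inv ht]
  congr 1
  rw [mul_pow, Real.sq_sqrt ht.le]
  norm_cast
  field_simp

lemma cexp_cpow (r : ℝ) (w : ℂ) : (cexp (r : ℂ)) ^ w = cexp (r * w) := by
  rw [Complex.cpow_def_of_ne_zero (Complex.exp_ne_zero _), ← Complex.ofReal_exp,
    ← Complex.ofReal_log (Real.exp_pos _).le, Real.log_exp]

lemma theta3_eq (x : ℝ) {t : ℝ} (ht : 0 < t) :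
    theta3 (Real.pi * x) (cexp ((-(Real.pi * t) : ℝ) : ℂ)) = T3 x t := by
  have h := HurwitzZeta.hasSum_nat_cosKernel₀ x ht
  have h1 : T3 x t = HurwitzZeta.cosKernel x t := by
    apply Complex.ofReal_injective
    rw [ofReal_T3, HurwitzZeta.cosKernel_def]
  rw [← h1] at h
  have h2 := Complex.hasSum_ofReal.mpr h
  rw [theta3, ← tsum_mul_left]
  have h3 : ∀ n : ℕ, 2 * (cexp ((-(Real.pi * t) : ℝ) : ℂ) ^ ((n + 1) ^ 2) *
      Complex.cos (2 * ((n : ℂ) + 1) * (Real.pi * x))) =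
      ((2 * Real.cos (2 * Real.pi * x * (n + 1)) * Real.exp (-Real.pi * (n + 1) ^ 2 * t) : ℝ) : ℂ) := by
    intro n
    rw [← Complex.exp_nat_mul]
    push_cast
    ring_nf
  simp only [h3]
  rw [h2.tsum_eq]
  push_cast
  ring

lemma ccos_add_nat (z : ℂ) (n : ℕ) :
    Complex.cos (z + n * Real.pi) = (-1) ^ n * Complex.cos z := by
  induction n with
  | zero => simp
  | succ k ih =>
    rw [show z + ((k + 1 : ℕ) : ℂ) * Real.pi = (z + k * Real.pi) + Real.pi by push_cast; ring,
      Complex.cos_add_pi, ih]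
    ring

lemma theta4_eq (x : ℝ) {t : ℝ} (ht : 0 < t) :
    theta4 (Real.pi * x) (cexp ((-(Real.pi * t) : ℝ) : ℂ)) = T3 (x + 1 / 2) t := by
  rw [← theta3_eq _ ht, theta3, theta4]
  congr 3
  ext n
  have : Complex.cos (2 * ((n : ℂ) + 1) * (Real.pi * ((x + 1 / 2 : ℝ) : ℂ))) =
      (-1) ^ (n + 1) * Complex.cos (2 * ((n : ℂ) + 1) * (Real.pi * x)) := by
    have h := ccos_add_nat (2 * ((n : ℂ) + 1) * (Real.pi * x)) (n + 1)
    rw [← h]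
    congr 1
    push_cast
    ring
  rw [this]
  ring

lemma theta2_eq (x : ℝ) {t : ℝ} (ht : 0 < t) :
    theta2 (Real.pi * x) (cexp ((-(Real.pi * t) : ℝ) : ℂ)) = T2 x t := by
  have h := (hasSum_thB x (τ := I * t) (by simpa using ht)).nat_add_neg_add_one
  rw [ofReal_T2, ← h.tsum_eq, theta2, ← tsum_mul_left]
  congr 1
  ext n
  rw [cexp_cpow, Complex.cos, mul_div_assoc', mul_div_assoc', mul_div_cancel_left₀ _ two_ne_zero,
    mul_add, ← Complex.exp_add, ← Complex.exp_add]
  congr 2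
  · push_cast
    linear_combination (-(Real.pi * t * ((n : ℂ) + 1 / 2) ^ 2)) * I_sq
  · push_cast
    linear_combination (-(Real.pi * t * ((n : ℂ) + 1 / 2) ^ 2)) * I_sq

lemma theta1_eq (x : ℝ) {t : ℝ} (ht : 0 < t) :
    theta1 (Real.pi * x) (cexp ((-(Real.pi * t) : ℝ) : ℂ)) = ((- T2 (x + 1 / 2) t : ℝ) : ℂ) := by
  rw [Complex.ofReal_neg (T2 (x + 1 / 2) t), ← theta2_eq _ ht, theta1, theta2]
  generalize cexp ((-(Real.pi * t) : ℝ) : ℂ) = q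
  rw [← mul_neg, ← tsum_neg]
  congr 2
  ext n
  have : Complex.cos ((2 * (n : ℂ) + 1) * (Real.pi * ((x + 1 / 2 : ℝ) : ℂ))) =
      - ((-1) ^ n * Complex.sin ((2 * (n : ℂ) + 1) * (Real.pi * x))) := by
    have h := ccos_add_nat ((2 * (n : ℂ) + 1) * (Real.pi * x) + Real.pi / 2) n
    rw [Complex.cos_add_pi_div_two, mul_neg] at h
    rw [← h]
    congr 1
    push_cast
    ring
  rw [this]
  ring

lemma arg_eq (u : ℝ) {t : ℝ} (ht : 0 < t) :
    (Real.pi : ℂ) * ((KR (lam t) * u : ℝ) : ℂ) / (2 * ellK (lam t)) = Real.pi * ((u / 2 : ℝ) : ℂ) := by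
  have h0 := T3_pos 0 ht
  have hp := Real.pi_pos
  rw [KR_lam ht, ellK_lam ht]
  norm_cast
  field_simp

section thetas
variable (u : ℝ) {t : ℝ}

lemma zero_eq : (0 : ℂ) = Real.pi * ((0 : ℝ) : ℂ) := by simp

lemma snR_lam (ht : 0 < t) : snR (KR (lam t) * u) (lam t) =
    T3 0 t / T2 0 t * (- T2 (u / 2 + 1 / 2) t / T3 (u / 2 + 1 / 2) t) := by
  rw [snR, sn, arg_eq u ht, nome_lam ht, zero_eq, theta3_eq _ ht, theta2_eq _ ht,
    theta1_eq _ ht, theta4_eq _ ht]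
  norm_cast

lemma cnR_lam (ht : 0 < t) : cnR (KR (lam t) * u) (lam t) =
    T3 (1 / 2) t / T2 0 t * (T2 (u / 2) t / T3 (u / 2 + 1 / 2) t) := by
  rw [cnR, cn, arg_eq u ht, nome_lam ht, zero_eq, theta4_eq _ ht, theta2_eq _ ht,
    theta2_eq _ ht, theta4_eq _ ht, zero_add]
  norm_cast

lemma dnR_lam (ht : 0 < t) : dnR (KR (lam t) * u) (lam t) =
    T3 (1 / 2) t / T3 0 t * (T3 (u / 2) t / T3 (u / 2 + 1 / 2) t) := by
  rw [dnR, dn, arg_eq u ht, nome_lam ht, zero_eq, theta4_eq _ ht, theta3_eq _ ht,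
    theta3_eq _ ht, theta4_eq _ ht, zero_add]
  norm_cast

lemma sn_sq_add_cn_sq (ht : 0 < t) : snR (KR (lam t) * u) (lam t) ^ 2
    + cnR (KR (lam t) * u) (lam t) ^ 2 = 1 := by
  have h := sn_cn_rel (u / 2) ht
  have h1 := T3_pos (u / 2 + 1 / 2) ht
  have h2 := T2_zero_pos ht
  rw [snR_lam u ht, cnR_lam u ht]
  generalize T3 (u / 2 + 1 / 2) t = A at *
  generalize T2 (u / 2 + 1 / 2) t = B at *
  field_simp
  linarith

lemma dn_sq_add_sn_sq (ht : 0 < t) : dnR (KR (lam t) * u) (lam t) ^ 2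
    + lam t * snR (KR (lam t) * u) (lam t) ^ 2 = 1 := by
  have h := sn_dn_rel (u / 2) ht
  have h1 := T3_pos (u / 2 + 1 / 2) ht
  have h2 := T2_zero_pos ht
  have h3 := T3_pos 0 ht
  rw [snR_lam u ht, dnR_lam u ht, lam_eq ht]
  generalize T3 (u / 2 + 1 / 2) t = A at *
  generalize T2 (u / 2 + 1 / 2) t = B at *
  field_simp
  linarith

lemma cn_ne (hu : u ∈ Ioo (1 / 2 : ℝ) 1) (ht : 0 < t) : cnR (KR (lam t) * u) (lam t) ≠ 0 := by
  have h1 := T3_pos (u / 2 + 1 / 2) ht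
  have h2 := T2_zero_pos ht
  have h3 := T3_pos (1 / 2) ht
  have h4 : 0 < T2 (u / 2) t := T2_pos (by rw [abs_lt]; constructor <;> linarith [hu.1, hu.2]) ht
  rw [cnR_lam u ht]
  positivity

noncomputable def thD (x t : ℝ) : ℝ := (T2 0 t / T3 0 t * (T3 x t / T2 x t)) ^ 2

lemma dc_sq_lam (ht : 0 < t) :
    (dnR (KR (lam t) * u) (lam t) / cnR (KR (lam t) * u) (lam t)) ^ 2 = thD (u / 2) t := by
  have h1 := T3_pos (u / 2 + 1 / 2) ht
  have h2 := T2_zero_pos ht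
  have h3 := T3_pos (1 / 2) ht
  have h4 := T3_pos 0 ht
  rw [cnR_lam u ht, dnR_lam u ht, thD]
  generalize T3 (u / 2 + 1 / 2) t = A at *
  congr 1
  field_simp

lemma phi_lam (ht : 0 < t) : phi u (lam t) = thD (u / 2) (1 / t) - thD (u / 2) t := by
  rw [phi, dc_sq_lam u ht, ← lam_inv ht, dc_sq_lam u (by positivity)]

end thetas

lemma sn_algebra {μ s c d s₁ c₁ d₁ : ℝ} (hμ : 0 < μ)
    (h1 : s ^ 2 + c ^ 2 = 1) (h2 : d ^ 2 + μ * s ^ 2 = 1)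
    (h3 : s₁ ^ 2 + c₁ ^ 2 = 1) (h4 : d₁ ^ 2 + (1 - μ) * s₁ ^ 2 = 1) (hc : c ≠ 0) (hc₁ : c₁ ≠ 0) :
    0 < 1 - d ^ 2 * s₁ ^ 2 ∧
    μ * (s ^ 2 * d₁ ^ 2 + c ^ 2 * d ^ 2 * s₁ ^ 2 * c₁ ^ 2) / (1 - d ^ 2 * s₁ ^ 2) ^ 2 - 1 =
      ((d₁ / c₁) ^ 2 - (d / c) ^ 2 - 1) * (c ^ 2 * c₁ ^ 2 / (1 - d ^ 2 * s₁ ^ 2)) := by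
  have hpos : 0 < 1 - d ^ 2 * s₁ ^ 2 := by
    have : 1 - d ^ 2 * s₁ ^ 2 = c₁ ^ 2 + μ * s ^ 2 * s₁ ^ 2 := by
      linear_combination (-s₁ ^ 2) * h2 - h3
    rw [this]
    positivity
  refine ⟨hpos, ?_⟩
  have hne := hpos.ne'
  field_simp
  have e1 : d ^ 2 = 1 - μ * s ^ 2 := by linarith
  have e2 : d₁ ^ 2 = 1 - (1 - μ) * s₁ ^ 2 := by linarith
  have e3 : c ^ 2 = 1 - s ^ 2 := by linarith
  have e4 : c₁ ^ 2 = 1 - s₁ ^ 2 := by linarith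
  rw [e1, e2, e3, e4]
  ring

lemma snAbsSq_lam {u : ℝ} (hu : u ∈ Ioo (1 / 2 : ℝ) 1) {t m : ℝ} (ht : 0 < t) (hm : 1 / m = lam t) :
    ∃ k : ℝ, 0 < k ∧ snAbsSq u m - 1 = (phi u (lam t) - 1) * k := by
  have ht' : 0 < 1 / t := by positivity
  have a1 := sn_sq_add_cn_sq u ht
  have a2 := dn_sq_add_sn_sq u ht
  have a3 := sn_sq_add_cn_sq u ht'
  have a4 := dn_sq_add_sn_sq u ht'
  have a5 := cn_ne u hu ht
  have a6 := cn_ne u hu ht'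
  rw [lam_inv ht] at a3 a4 a6
  obtain ⟨h1, h2⟩ := sn_algebra (lam_pos ht) a1 a2 a3 a4 a5 a6
  refine ⟨_, div_pos (mul_pos (sq_pos_iff.mpr a5) (sq_pos_iff.mpr a6)) h1, ?_⟩
  simp only [snAbsSq, phi, hm]
  exact h2


lemma lam_continuousAt {t : ℝ} (ht : 0 < t) : ContinuousAt lam t := by
  have h := ((continuousAt_T3 (1 / 2) ht).div (continuousAt_T3 0 ht) (T3_pos 0 ht).ne').pow 4
  exact continuousAt_const.sub h

lemma lam_inj {s t : ℝ} (hs : 0 < s) (ht : 0 < t) (h : lam s = lam t) : s = t := by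
  rw [← ratio_lam hs, ← ratio_lam ht, h]

lemma tendsto_lam : Tendsto lam atTop (nhds 0) := by
  have h := ((tendsto_T3 (1 / 2)).div (tendsto_T3 0) one_ne_zero).pow 4
  have h2 := (tendsto_const_nhds (x := (1 : ℝ))).sub h
  norm_num at h2
  refine h2.congr fun t => ?_
  simp [lam]

lemma exists_lam_gt {c s : ℝ} (hc : c < 1) (hs : 0 < s) : ∃ r, 0 < r ∧ r < s ∧ c < lam r := by
  have h1 := tendsto_lam.eventually (gt_mem_nhds (show (0 : ℝ) < 1 - c by linarith))
  obtain ⟨a, ha, hb⟩ := (h1.and (eventually_gt_atTop (1 / s))).exists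
  have hs' : 0 < 1 / s := by positivity
  have ha0 : 0 < a := hs'.trans hb
  refine ⟨1 / a, by positivity, ?_, ?_⟩
  · rw [div_lt_iff₀ ha0]
    rw [div_lt_iff₀ hs] at hb
    linarith
  · rw [lam_inv ha0]; linarith

lemma lam_contOn {a b : ℝ} (ha : 0 < a) : ContinuousOn lam (Icc a b) :=
  fun _ hx => (lam_continuousAt (ha.trans_le hx.1)).continuousWithinAt

lemma lam_anti {s t : ℝ} (hs : 0 < s) (hst : s < t) : lam t < lam s := by
  have ht := hs.trans hst
  by_contra hcon
  obtain ⟨r, hr, hrs, hrl⟩ := exists_lam_gt (lam_lt_one ht) hs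
  have := intermediate_value_Icc' hrs.le (lam_contOn (b := s) hr)
  obtain ⟨p, hp, hpe⟩ := this ⟨not_lt.mp hcon, hrl.le⟩
  have := lam_inj (hr.trans_le hp.1) ht hpe
  linarith [hp.2]

lemma lam_one : lam 1 = 1 / 2 := by
  have h := lam_inv one_pos
  rw [div_one] at h
  linarith

lemma exists_lam {c : ℝ} (h0 : 1 / 2 < c) (h1 : c < 1) : ∃ t, 0 < t ∧ t < 1 ∧ lam t = c := by
  obtain ⟨r, hr, hrs, hrl⟩ := exists_lam_gt h1 one_pos
  have := intermediate_value_Icc' hrs.le (lam_contOn (b := 1) hr)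
  obtain ⟨p, hp, hpe⟩ := this ⟨by rw [lam_one]; exact h0.le, hrl.le⟩
  refine ⟨p, hr.trans_le hp.1, lt_of_le_of_ne hp.2 ?_, hpe⟩
  rintro rfl
  rw [lam_one] at hpe
  linarith

lemma thD_continuousAt {x t : ℝ} (hx : |x| < 1 / 2) (ht : 0 < t) : ContinuousAt (thD x) t :=
  ((((continuousAt_T2 0 ht).div (continuousAt_T3 0 ht) (T3_pos 0 ht).ne').mul
    ((continuousAt_T3 x ht).div (continuousAt_T2 x ht) (T2_pos hx ht).ne')).pow 2)

lemma tendsto_thD {x : ℝ} (hx : |x| < 1 / 2) :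
    Tendsto (thD x) atTop (nhds ((1 / Real.cos (Real.pi * x)) ^ 2)) := by
  have hc : 0 < Real.cos (Real.pi * x) := by
    rw [abs_lt] at hx
    apply Real.cos_pos_of_mem_Ioo
    constructor <;> nlinarith [Real.pi_pos]
  have h1 := (((tendsto_T2 0).div (tendsto_T2 x) (by positivity)).mul
    ((tendsto_T3 x).div (tendsto_T3 0) one_ne_zero)).pow 2
  have e : (2 * Real.cos (Real.pi * 0) / (2 * Real.cos (Real.pi * x)) * (1 / 1)) ^ 2 =
      (1 / Real.cos (Real.pi * x)) ^ 2 := by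
    rw [mul_zero, Real.cos_zero]
    field_simp
  rw [e] at h1
  refine h1.congr fun t => ?_
  simp only [Pi.div_apply]
  rw [thD, mul_div_mul_left _ _ (Real.exp_pos _).ne']
  ring

lemma thD_inv {x t : ℝ} (ht : 0 < t) : thD x (1 / t) =
    (thG (1 / 2) 0 t / thG 0 0 t * (thG 0 (-x) t / thG (1 / 2) (-x) t)) ^ 2 := by
  have ht' : 0 < 1 / t := by positivity
  have hs := Real.sqrt_pos.mpr ht'
  rw [thD, T3_functional x ht', T2_functional x ht', T3_functional 0 ht', T2_functional 0 ht',
    neg_zero, one_div_one_div]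
  rw [mul_div_mul_left _ _ (by positivity), mul_div_mul_left _ _ (by positivity)]

lemma tendsto_thD_inv {x : ℝ} (hx : |x| < 1 / 2) :
    Tendsto (fun t => thD x (1 / t)) atTop (nhds 1) := by
  have hx' : |-x| < 1 / 2 := by rwa [abs_neg]
  have h0 : |(0 : ℝ)| < 1 / 2 := by norm_num
  have h1 := (((tendsto_thG_one (1 / 2) 0 h0).div (tendsto_thG_one 0 0 h0) one_ne_zero).mul
    ((tendsto_thG_one 0 (-x) hx').div (tendsto_thG_one (1 / 2) (-x) hx') one_ne_zero)).pow 2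
  norm_num only at h1
  refine h1.congr' ?_
  filter_upwards [eventually_gt_atTop 0] with t ht
  rw [thD_inv ht]
  norm_num

/-- The dc difference as a function of the lattice parameter. -/
def Ph (x t : ℝ) : ℝ := thD x (1 / t) - thD x t

lemma Ph_contOn {x a b : ℝ} (hx : |x| < 1 / 2) (ha : 0 < a) : ContinuousOn (Ph x) (Icc a b) := by
  intro t ht
  have ht0 : 0 < t := ha.trans_le ht.1
  have h1 : ContinuousAt (fun t : ℝ => 1 / t) t := continuousAt_const.div continuousAt_id ht0.ne'
  have h2 : ContinuousAt (fun t : ℝ => thD x (1 / t)) t :=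
    ContinuousAt.comp (f := fun t : ℝ => 1 / t) (thD_continuousAt hx (by positivity)) h1
  exact (h2.sub (thD_continuousAt hx ht0)).continuousWithinAt

lemma Ph_one (x : ℝ) : Ph x 1 = 0 := by simp [Ph]

lemma exists_Ph_gt {u s : ℝ} (hu : u ∈ Ioo (1 / 2 : ℝ) 1) (hs : 0 < s) :
    ∃ r, 0 < r ∧ r < s ∧ 1 < Ph (u / 2) r := by
  have hx : |u / 2| < 1 / 2 := by rw [abs_lt]; constructor <;> linarith [hu.1, hu.2]
  have h1 := (tendsto_thD hx).sub (tendsto_thD_inv hx)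
  have hp := Real.pi_pos
  have hc : 0 < Real.cos (Real.pi * (u / 2)) := by
    apply Real.cos_pos_of_mem_Ioo
    constructor <;> nlinarith [hu.1, hu.2]
  have hc2 : Real.cos (Real.pi * (u / 2)) ^ 2 < 1 / 2 := by
    have h := Real.cos_sq (Real.pi * (u / 2))
    have h3 : Real.cos (2 * (Real.pi * (u / 2))) < 0 := by
      apply Real.cos_neg_of_pi_div_two_lt_of_lt <;> nlinarith [hu.1, hu.2]
    linarith
  have hgt : 1 < (1 / Real.cos (Real.pi * (u / 2))) ^ 2 - 1 := by
    have : 2 < (1 / Real.cos (Real.pi * (u / 2))) ^ 2 := by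
      rw [div_pow, one_pow, lt_div_iff₀ (by positivity)]
      linarith
    linarith
  obtain ⟨a, ha, hb⟩ := ((h1.eventually (lt_mem_nhds hgt)).and (eventually_gt_atTop (1 / s))).exists
  have hs' : 0 < 1 / s := by positivity
  have ha0 : 0 < a := hs'.trans hb
  refine ⟨1 / a, by positivity, ?_, ?_⟩
  · rw [div_lt_iff₀ ha0]
    rw [div_lt_iff₀ hs] at hb
    linarith
  · rw [Ph, one_div_one_div]; exact ha

/-- For `u ∈ (1/2,1)` and `m̃ ∈ (1,2)` the unique solution in
`(1,2)` of `dc²(K(1−1/m)u | 1−1/m) − dc²(K(1/m)u | 1/m) = 1`, the continuously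
extended modulus satisfies `|sn(K(m)u|m)| > 1` on `(1, m̃)` and `< 1` on
`(m̃, 2)`. -/
theorem sn_abs_cut_dichotomy (u : ℝ) (hu : u ∈ Set.Ioo (1 / 2 : ℝ) 1)
    (mt : ℝ) (hmt : mt ∈ Set.Ioo (1 : ℝ) 2) (heq : phi u (1 / mt) = 1)
    (huniq : ∀ m ∈ Set.Ioo (1 : ℝ) 2, phi u (1 / m) = 1 → m = mt) :
    (∀ m ∈ Set.Ioo (1 : ℝ) mt, 1 < Real.sqrt (snAbsSq u m)) ∧
    (∀ m ∈ Set.Ioo mt (2 : ℝ), Real.sqrt (snAbsSq u m) < 1) := by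
  have hx : |u / 2| < 1 / 2 := by rw [abs_lt]; constructor <;> linarith [hu.1, hu.2]
  have key : ∀ m ∈ Set.Ioo (1 : ℝ) 2, ∃ t, 0 < t ∧ t < 1 ∧ lam t = 1 / m := by
    intro m hm
    apply exists_lam
    · exact one_div_lt_one_div_of_lt (by linarith [hm.1]) hm.2
    · rw [div_lt_one (by linarith [hm.1])]; exact hm.1
  obtain ⟨tt, htt0, htt1, htt⟩ := key mt hmt
  have hmt0 : 0 < mt := by linarith [hmt.1]
  have uniq : ∀ r, 0 < r → r < 1 → Ph (u / 2) r = 1 → r = tt := by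
    intro r hr0 hr1 hr
    have h1 := lam_lt_one hr0
    have h2 := lam_pos hr0
    have h3 : 1 / 2 < lam r := by rw [← lam_one]; exact lam_anti hr0 hr1
    have h4 : 1 / lam r = mt := by
      apply huniq
      · constructor
        · rw [lt_div_iff₀ h2]; linarith
        · rw [div_lt_iff₀ h2]; linarith
      · rw [one_div_one_div, phi_lam u hr0]; exact hr
    apply lam_inj hr0 htt0
    rw [htt, ← h4, one_div_one_div]
  constructor
  · intro m hm
    have hm0 : 0 < m := by linarith [hm.1]
    obtain ⟨t, ht0, ht1, ht⟩ := key m ⟨hm.1, hm.2.trans hmt.2⟩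
    have hlt : t < tt := by
      by_contra hcon
      have h1 : lam t ≤ lam tt := by
        rcases (not_lt.mp hcon).eq_or_lt with h | h
        · rw [h]
        · exact (lam_anti htt0 h).le
      rw [ht, htt] at h1
      exact absurd (one_div_lt_one_div_of_lt hm0 hm.2) (not_lt.mpr h1)
    have hP : 1 < Ph (u / 2) t := by
      by_contra hcon
      obtain ⟨r, hr0, hrt, hr⟩ := exists_Ph_gt hu ht0
      have := intermediate_value_Icc' hrt.le (Ph_contOn (b := t) hx hr0)
      obtain ⟨p, hp, hpe⟩ := this ⟨not_lt.mp hcon, hr.le⟩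
      have := uniq p (hr0.trans_le hp.1) (hp.2.trans_lt ht1) hpe
      linarith [hp.2]
    obtain ⟨k, hk, hS⟩ := snAbsSq_lam hu ht0 ht.symm
    rw [phi_lam u ht0] at hS
    have h5 : 0 < (Ph (u / 2) t - 1) * k := mul_pos (by linarith) hk
    rw [Ph, ← hS] at h5
    rw [Real.lt_sqrt zero_le_one]
    linarith
  · intro m hm
    have hm1 : 1 < m := hmt.1.trans hm.1
    obtain ⟨t, ht0, ht1, ht⟩ := key m ⟨hm1, hm.2⟩
    have hlt : tt < t := by
      by_contra hcon
      have h1 : lam tt ≤ lam t := by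
        rcases (not_lt.mp hcon).eq_or_lt with h | h
        · rw [h]
        · exact (lam_anti ht0 h).le
      rw [ht, htt] at h1
      exact absurd (one_div_lt_one_div_of_lt hmt0 hm.1) (not_lt.mpr h1)
    have hP : Ph (u / 2) t < 1 := by
      by_contra hcon
      have := intermediate_value_Icc' ht1.le (Ph_contOn (b := 1) hx ht0)
      obtain ⟨p, hp, hpe⟩ := this ⟨by rw [Ph_one]; exact zero_le_one, not_lt.mp hcon⟩
      have hp1 : p < 1 := by
        refine lt_of_le_of_ne hp.2 ?_
        rintro rfl
        rw [Ph_one] at hpe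
        exact zero_ne_one hpe
      have := uniq p (ht0.trans_le hp.1) hp1 hpe
      linarith [hp.1]
    obtain ⟨k, hk, hS⟩ := snAbsSq_lam hu ht0 ht.symm
    rw [phi_lam u ht0] at hS
    have h5 : (Ph (u / 2) t - 1) * k < 0 := mul_neg_of_neg_of_pos (by linarith) hk
    rw [Ph, ← hS] at h5
    rw [Real.sqrt_lt' one_pos]
    linarith
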